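/- arXiv:2602.23529 — 2 statements merged into one kernel-verified Lean document; each statement's English description precedes it below -/
import Mathlib

section
/- Let N be a finite ground set and f : 2^N → ℝ a subadditive set function with f(∅) = 0. Then the ℓ¹-divergence is subadditive in the set of revealed subsets: for all 𝒦, ℒ ⊆ 2^N ∖ 𝒦₀ with 𝒦 ∩ ℒ = ∅ one has Δ_f(𝒦) + Δ_f(ℒ) ≥ Δ_f(𝒦 ∪ ℒ). -/
open Finset

/-- The minimal information family: the empty set, the ground set, and all singletons. -/
def K0 (N : Type*) [Fintype N] : Set (Finset N) :=
  {∅, (Finset.univ : Finset N)} ∪ {S : Finset N | ∃ i : N, S = {i}}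

/-- A set function is subadditive if `f (S ∪ T) ≤ f S + f T` for disjoint `S`, `T`. -/
def SubadditiveSF {N : Type*} [DecidableEq N] (f : Finset N → ℝ) : Prop :=
  ∀ S T : Finset N, Disjoint S T → f (S ∪ T) ≤ f S + f T

/-- A set function is monotone if `S ⊆ T` implies `f S ≤ f T`. -/
def MonotoneSF {N : Type*} (f : Finset N → ℝ) : Prop :=
  ∀ S T : Finset N, S ⊆ T → f S ≤ f T

/-- Elementwise monotonicity: `f S ≤ f (S ∪ {i})`. -/
def MonotoneStep {N : Type*} [DecidableEq N] (f : Finset N → ℝ) : Prop :=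
  ∀ (S : Finset N) (i : N), i ∉ S → f S ≤ f (insert i S)

/-- Upper completion: minimum of `∑ f Sᵢ` over families of pairwise disjoint nonempty
sets `Sᵢ ∈ K` partitioning `S`; it is `0` at `∅`. -/
noncomputable def upperC {N : Type*} [DecidableEq N] (f : Finset N → ℝ)
    (K : Set (Finset N)) (S : Finset N) : ℝ :=
  if S = ∅ then 0 else
    sInf {x : ℝ | ∃ P : Finset (Finset N),
      (∀ T ∈ P, T ∈ K) ∧ (∀ T ∈ P, T ≠ ∅) ∧
      (∀ T₁ ∈ P, ∀ T₂ ∈ P, T₁ ≠ T₂ → Disjoint T₁ T₂) ∧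
      P.sup id = S ∧ x = ∑ T ∈ P, f T}

/-- Lower completion: maximum of `f T - upperC f K (T \ S)` over `T ∈ K` with `S ⊆ T`. -/
noncomputable def lowerC {N : Type*} [DecidableEq N] (f : Finset N → ℝ)
    (K : Set (Finset N)) (S : Finset N) : ℝ :=
  sSup {x : ℝ | ∃ T ∈ K, S ⊆ T ∧ x = f T - upperC f K (T \ S)}

/-- The ℓ¹-divergence of `f` with revealed family `K ⊆ 2^N \ K0`. -/
noncomputable def ldiv {N : Type*} [Fintype N] [DecidableEq N] (f : Finset N → ℝ)
    (K : Set (Finset N)) : ℝ :=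
  ∑ T : Finset N, (upperC f (K0 N ∪ K) T - lowerC f (K0 N ∪ K) T)

/-- SAM upper completion: minimum of `∑ f Sᵢ` over nonempty finite families
`S₁, …, S_k ∈ K` covering `S`. -/
noncomputable def samUpper {N : Type*} [DecidableEq N] (f : Finset N → ℝ)
    (K : Set (Finset N)) (S : Finset N) : ℝ :=
  sInf {x : ℝ | ∃ (k : ℕ) (Ss : Fin (k + 1) → Finset N),
    (∀ i, Ss i ∈ K) ∧ S ⊆ Finset.univ.sup Ss ∧ x = ∑ i, f (Ss i)}

/-- SAM lower completion. -/
noncomputable def samLower {N : Type*} [DecidableEq N] (f : Finset N → ℝ)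
    (K : Set (Finset N)) (S : Finset N) : ℝ :=
  max (sSup {x : ℝ | ∃ Y ∈ K, Y ⊆ S ∧ x = f Y})
      (sSup {x : ℝ | ∃ X ∈ K, S ⊆ X ∧ x = f X - samUpper f K (X \ S)})

/-- The SAM ℓ¹-divergence. -/
noncomputable def samDiv {N : Type*} [Fintype N] [DecidableEq N] (f : Finset N → ℝ)
    (K : Set (Finset N)) : ℝ :=
  ∑ T : Finset N, (samUpper f (K0 N ∪ K) T - samLower f (K0 N ∪ K) T)

/-- `{(α i, T i)}` is a fractional cover of `S`. -/
def IsFracCover {N : Type*} [DecidableEq N] (S : Finset N) (k : ℕ)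
    (α : Fin k → ℝ) (T : Fin k → Finset N) : Prop :=
  (∀ i, 0 < α i) ∧
  ∀ j ∈ S, (1 : ℝ) ≤ ∑ i ∈ Finset.univ.filter (fun i => j ∈ T i), α i

/-- A set function is fractionally subadditive. -/
def FracSubadditive {N : Type*} [DecidableEq N] (f : Finset N → ℝ) : Prop :=
  ∀ (S : Finset N) (k : ℕ) (α : Fin k → ℝ) (T : Fin k → Finset N),
    IsFracCover S k α T → f S ≤ ∑ i, α i * f (T i)

/-- XOS: pointwise maximum of finitely many nonnegative additive set functions. -/
def IsXOS {N : Type*} (f : Finset N → ℝ) : Prop :=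
  ∃ (s : ℕ) (a : Fin (s + 1) → N → ℝ),
    (∀ i j, 0 ≤ a i j) ∧
    ∀ S : Finset N, f S = Finset.univ.sup' Finset.univ_nonempty (fun i => ∑ j ∈ S, a i j)

/-- XOS upper completion: infimum of `∑ αᵢ f Tᵢ` over fractional covers of `S`
using sets from `K`. -/
noncomputable def xosUpper {N : Type*} [DecidableEq N] (f : Finset N → ℝ)
    (K : Set (Finset N)) (S : Finset N) : ℝ :=
  sInf {x : ℝ | ∃ (k : ℕ) (α : Fin k → ℝ) (T : Fin k → Finset N),
    IsFracCover S k α T ∧ (∀ i, T i ∈ K) ∧ x = ∑ i, α i * f (T i)}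

theorem SubadditiveSF.sup_le_sum {N : Type*} [DecidableEq N] {f : Finset N → ℝ}
    (hf0 : f ∅ = 0) (hsub : SubadditiveSF f) (P : Finset (Finset N))
    (hP : ∀ T₁ ∈ P, ∀ T₂ ∈ P, T₁ ≠ T₂ → Disjoint T₁ T₂) :
    f (P.sup id) ≤ ∑ T ∈ P, f T := by
  induction P using Finset.induction_on with
  | empty => simp [hf0]
  | insert A P hA ih =>
    rw [Finset.sup_insert, Finset.sum_insert hA]
    have hdisj : Disjoint A (P.sup id) := by
      rw [Finset.disjoint_sup_right]
      intro T hT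
      exact hP A (mem_insert_self A P) T (mem_insert_of_mem hT) (fun h => hA (h ▸ hT))
    have hrest := ih fun T₁ h₁ T₂ h₂ =>
      hP T₁ (mem_insert_of_mem h₁) T₂ (mem_insert_of_mem h₂)
    exact (hsub A (P.sup id) hdisj).trans (by gcongr)

/-- The values `∑ f Sᵢ` over partitions of `S` into members of `K`. -/
def partitionValues {N : Type*} [DecidableEq N] (f : Finset N → ℝ)
    (K : Set (Finset N)) (S : Finset N) : Set ℝ :=
  {x : ℝ | ∃ P : Finset (Finset N),
    (∀ T ∈ P, T ∈ K) ∧ (∀ T ∈ P, T ≠ ∅) ∧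
    (∀ T₁ ∈ P, ∀ T₂ ∈ P, T₁ ≠ T₂ → Disjoint T₁ T₂) ∧
    P.sup id = S ∧ x = ∑ T ∈ P, f T}

theorem upperC_of_ne_empty {N : Type*} [DecidableEq N] (f : Finset N → ℝ)
    (K : Set (Finset N)) {S : Finset N} (hS : S ≠ ∅) :
    upperC f K S = sInf (partitionValues f K S) :=
  if_neg hS

theorem SubadditiveSF.le_of_mem_partitionValues {N : Type*} [DecidableEq N] {f : Finset N → ℝ}
    (hf0 : f ∅ = 0) (hsub : SubadditiveSF f) {K : Set (Finset N)} {S : Finset N} {x : ℝ}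
    (hx : x ∈ partitionValues f K S) : f S ≤ x := by
  obtain ⟨P, -, -, hP, rfl, rfl⟩ := hx
  exact hsub.sup_le_sum hf0 P hP

theorem partitionValues_nonempty {N : Type*} [DecidableEq N] (f : Finset N → ℝ)
    {K : Set (Finset N)} (hK : ∀ i : N, {i} ∈ K) (S : Finset N) :
    (partitionValues f K S).Nonempty := by
  refine ⟨_, S.image singleton, ?_, ?_, ?_, ?_, rfl⟩
  · simpa using fun i _ => hK i
  · simp
  · simp only [mem_image]
    rintro _ ⟨i, -, rfl⟩ _ ⟨j, -, rfl⟩ hij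
    exact disjoint_singleton.2 fun h => hij (h ▸ rfl)
  · ext i
    simp

theorem partitionValues_mono {N : Type*} [DecidableEq N] (f : Finset N → ℝ)
    {K L : Set (Finset N)} (hKL : K ⊆ L) (S : Finset N) :
    partitionValues f K S ⊆ partitionValues f L S := by
  rintro x ⟨P, hPK, hP⟩
  exact ⟨P, fun T hT => hKL (hPK T hT), hP⟩

theorem SubadditiveSF.le_upperC {N : Type*} [DecidableEq N] {f : Finset N → ℝ}
    (hf0 : f ∅ = 0) (hsub : SubadditiveSF f) {K : Set (Finset N)}
    (hK : ∀ i : N, {i} ∈ K) (S : Finset N) : f S ≤ upperC f K S := by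
  by_cases hS : S = ∅
  · simp [upperC, hS, hf0]
  · rw [upperC_of_ne_empty f K hS]
    exact le_csInf (partitionValues_nonempty f hK S) fun x hx =>
      hsub.le_of_mem_partitionValues hf0 hx

theorem SubadditiveSF.upperC_anti {N : Type*} [DecidableEq N] {f : Finset N → ℝ}
    (hf0 : f ∅ = 0) (hsub : SubadditiveSF f) {K L : Set (Finset N)}
    (hK : ∀ i : N, {i} ∈ K) (hKL : K ⊆ L) (S : Finset N) :
    upperC f L S ≤ upperC f K S := by
  by_cases hS : S = ∅
  · simp [upperC, hS]
  · rw [upperC_of_ne_empty f K hS, upperC_of_ne_empty f L hS]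
    exact csInf_le_csInf ⟨f S, fun x hx => hsub.le_of_mem_partitionValues hf0 hx⟩
      (partitionValues_nonempty f hK S) (partitionValues_mono f hKL S)

theorem SubadditiveSF.sub_upperC_le {N : Type*} [DecidableEq N] {f : Finset N → ℝ}
    (hf0 : f ∅ = 0) (hsub : SubadditiveSF f) {K : Set (Finset N)}
    (hK : ∀ i : N, {i} ∈ K) {S T : Finset N} (hST : S ⊆ T) :
    f T - upperC f K (T \ S) ≤ f S := by
  have h := hsub S (T \ S) disjoint_sdiff
  rw [union_sdiff_of_subset hST] at h
  linarith [hsub.le_upperC hf0 hK (T \ S)]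

theorem SubadditiveSF.lowerC_le {N : Type*} [Fintype N] [DecidableEq N] {f : Finset N → ℝ}
    (hf0 : f ∅ = 0) (hsub : SubadditiveSF f) {K : Set (Finset N)}
    (hK : ∀ i : N, {i} ∈ K) (huniv : univ ∈ K) (S : Finset N) : lowerC f K S ≤ f S := by
  refine csSup_le ⟨_, univ, huniv, subset_univ S, rfl⟩ ?_
  rintro _ ⟨T, -, hST, rfl⟩
  exact hsub.sub_upperC_le hf0 hK hST

theorem SubadditiveSF.lowerC_mono {N : Type*} [Fintype N] [DecidableEq N] {f : Finset N → ℝ}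
    (hf0 : f ∅ = 0) (hsub : SubadditiveSF f) {K L : Set (Finset N)}
    (hK : ∀ i : N, {i} ∈ K) (huniv : univ ∈ K) (hKL : K ⊆ L) (S : Finset N) :
    lowerC f K S ≤ lowerC f L S := by
  refine csSup_le ⟨_, univ, huniv, subset_univ S, rfl⟩ ?_
  rintro _ ⟨T, hT, hST, rfl⟩
  have hbdd : BddAbove {x : ℝ | ∃ T ∈ L, S ⊆ T ∧ x = f T - upperC f L (T \ S)} := by
    refine ⟨f S, ?_⟩
    rintro _ ⟨T, -, hST, rfl⟩
    exact hsub.sub_upperC_le hf0 (fun i => hKL (hK i)) hST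
  exact (sub_le_sub_left (hsub.upperC_anti hf0 hK hKL (T \ S)) (f T)).trans
    (le_csSup hbdd ⟨T, hKL hT, hST, rfl⟩)

theorem singleton_mem_K0_union {N : Type*} [Fintype N] (K : Set (Finset N)) (i : N) :
    {i} ∈ K0 N ∪ K :=
  Or.inl (Or.inr ⟨i, rfl⟩)

theorem univ_mem_K0_union {N : Type*} [Fintype N] (K : Set (Finset N)) :
    univ ∈ K0 N ∪ K :=
  Or.inl (Or.inl (Or.inr rfl))

theorem SubadditiveSF.ldiv_nonneg {N : Type*} [Fintype N] [DecidableEq N] {f : Finset N → ℝ}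
    (hf0 : f ∅ = 0) (hsub : SubadditiveSF f) (K : Set (Finset N)) : 0 ≤ ldiv f K :=
  Finset.sum_nonneg fun T _ => sub_nonneg.2 <|
    (hsub.lowerC_le hf0 (singleton_mem_K0_union K) (univ_mem_K0_union K) T).trans
      (hsub.le_upperC hf0 (singleton_mem_K0_union K) T)

theorem SubadditiveSF.ldiv_anti {N : Type*} [Fintype N] [DecidableEq N] {f : Finset N → ℝ}
    (hf0 : f ∅ = 0) (hsub : SubadditiveSF f) {K L : Set (Finset N)} (hKL : K ⊆ L) :
    ldiv f L ≤ ldiv f K := by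
  have h := Set.union_subset_union_right (K0 N) hKL
  exact Finset.sum_le_sum fun T _ => sub_le_sub
    (hsub.upperC_anti hf0 (singleton_mem_K0_union K) h T)
    (hsub.lowerC_mono hf0 (singleton_mem_K0_union K) (univ_mem_K0_union K) h T)

/-- the ℓ¹-divergence is subadditive in the set of revealed subsets. -/
theorem divergence_subadditive {N : Type*} [Fintype N] [DecidableEq N]
    (f : Finset N → ℝ) (hf0 : f ∅ = 0) (hsub : SubadditiveSF f)
    (K L : Set (Finset N)) (hK : K ⊆ (K0 N)ᶜ) (hL : L ⊆ (K0 N)ᶜ)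
    (hd : K ∩ L = ∅) :
    ldiv f (K ∪ L) ≤ ldiv f K + ldiv f L :=
  (hsub.ldiv_anti hf0 Set.subset_union_left).trans
    (le_add_of_nonneg_right (hsub.ldiv_nonneg hf0 L))
end

section
/- Let N be a finite ground set, 𝒦₀ ⊆ 𝒦 ⊆ 2^N, and let (f, 𝒦) with f(∅) = 0 admit at least one subadditive monotone extension. Then the SAM upper completion f̄ˢᵃᵐ_𝒦 is itself a subadditive monotone extension of (f, 𝒦); in particular f̄ˢᵃᵐ_𝒦(S) = f(S) for every S ∈ 𝒦, and the SAM upper completion is tight at every subset. -/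
open Finset

/-- The set of costs of nonempty finite `K`-covers of `S`. -/
def coverCosts {N : Type*} [DecidableEq N] (f : Finset N → ℝ)
    (K : Set (Finset N)) (S : Finset N) : Set ℝ :=
  {x : ℝ | ∃ (k : ℕ) (Ss : Fin (k + 1) → Finset N),
    (∀ i, Ss i ∈ K) ∧ S ⊆ Finset.univ.sup Ss ∧ x = ∑ i, f (Ss i)}

theorem samUpper_eq_sInf_coverCosts {N : Type*} [DecidableEq N] (f : Finset N → ℝ)
    (K : Set (Finset N)) (S : Finset N) : samUpper f K S = sInf (coverCosts f K S) :=
  rfl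

theorem MonotoneStep.monotoneSF {N : Type*} [DecidableEq N] {g : Finset N → ℝ}
    (hg : MonotoneStep g) : MonotoneSF g := by
  have key : ∀ S U : Finset N, g S ≤ g (U ∪ S) := by
    intro S U
    induction U using Finset.induction_on with
    | empty => simp
    | insert a U _ ih =>
      rw [Finset.insert_union]
      by_cases ha : a ∈ U ∪ S
      · rwa [Finset.insert_eq_of_mem ha]
      · exact ih.trans (hg _ a ha)
  intro S T hST
  simpa [Finset.union_eq_left.mpr hST] using key S T

theorem SubadditiveSF.union_le {N : Type*} [DecidableEq N] {g : Finset N → ℝ}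
    (hg : SubadditiveSF g) (hm : MonotoneSF g) (S T : Finset N) :
    g (S ∪ T) ≤ g S + g T := by
  have h := hg S (T \ S) Finset.disjoint_sdiff
  rw [Finset.union_sdiff_self_eq_union] at h
  linarith [hm (T \ S) T Finset.sdiff_subset]

theorem SubadditiveSF.sup_le_sum_s7 {N ι : Type*} [DecidableEq N] {g : Finset N → ℝ}
    (hg : SubadditiveSF g) (hm : MonotoneSF g) (h0 : g ∅ = 0)
    (s : Finset ι) (F : ι → Finset N) : g (s.sup F) ≤ ∑ i ∈ s, g (F i) := by
  classical
  induction s using Finset.induction_on with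
  | empty => simp [h0]
  | insert a s ha ih =>
    rw [Finset.sup_insert, Finset.sum_insert ha]
    exact (hg.union_le hm _ _).trans (by linarith)

/-- Every subadditive monotone extension is a lower bound for the cover costs. -/
theorem le_of_mem_coverCosts {N : Type*} [DecidableEq N] {f g : Finset N → ℝ}
    {K : Set (Finset N)} (hg : SubadditiveSF g) (hm : MonotoneSF g) (h0 : g ∅ = 0)
    (hfg : ∀ S ∈ K, g S = f S) {S : Finset N} {x : ℝ} (hx : x ∈ coverCosts f K S) :
    g S ≤ x := by
  obtain ⟨k, Ss, hK, hS, rfl⟩ := hx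
  calc g S ≤ g (Finset.univ.sup Ss) := hm _ _ hS
    _ ≤ ∑ i, g (Ss i) := hg.sup_le_sum_s7 hm h0 _ _
    _ = ∑ i, f (Ss i) := Finset.sum_congr rfl fun i _ => hfg _ (hK i)

theorem coverCosts_antitone {N : Type*} [DecidableEq N] (f : Finset N → ℝ)
    (K : Set (Finset N)) {S T : Finset N} (hST : S ⊆ T) :
    coverCosts f K T ⊆ coverCosts f K S := by
  rintro x ⟨k, Ss, hK, hT, rfl⟩
  exact ⟨k, Ss, hK, hST.trans hT, rfl⟩

theorem mem_coverCosts_of_subset {N : Type*} [DecidableEq N] (f : Finset N → ℝ)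
    {K : Set (Finset N)} {S T : Finset N} (hT : T ∈ K) (hST : S ⊆ T) :
    f T ∈ coverCosts f K S :=
  ⟨0, fun _ => T, fun _ => hT, by simpa using hST, by simp⟩

theorem add_mem_coverCosts_union {N : Type*} [DecidableEq N] {f : Finset N → ℝ}
    {K : Set (Finset N)} {S T : Finset N} {x y : ℝ} (hx : x ∈ coverCosts f K S)
    (hy : y ∈ coverCosts f K T) : x + y ∈ coverCosts f K (S ∪ T) := by
  obtain ⟨k, A, hAK, hA, rfl⟩ := hx
  obtain ⟨l, B, hBK, hB, rfl⟩ := hy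
  refine ⟨k + 1 + l, (Fin.append A B : Fin ((k + 1) + (l + 1)) → Finset N), ?_, ?_, ?_⟩
  · exact fun i => Fin.addCases (m := k + 1) (n := l + 1)
      (motive := fun i => Fin.append A B i ∈ K)
      (fun i => by simpa using hAK i) (fun i => by simpa using hBK i) i
  · apply Finset.union_subset
    · refine hA.trans (Finset.sup_le fun i _ => ?_)
      have h := Finset.le_sup (f := Fin.append A B) (Finset.mem_univ (Fin.castAdd (l + 1) i))
      rwa [Fin.append_left] at h
    · refine hB.trans (Finset.sup_le fun i _ => ?_)
      have h := Finset.le_sup (f := Fin.append A B) (Finset.mem_univ (Fin.natAdd (k + 1) i))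
      rwa [Fin.append_right] at h
  · have h := Fin.sum_univ_add (fun i => f (Fin.append A B i))
    simp only [Fin.append_left, Fin.append_right] at h
    exact h.symm

/-- if `(f, K)` has a SAM extension, the SAM upper completion is itself a
SAM extension; in particular it agrees with `f` on `K` and is tight at every subset. -/
theorem samUpper_is_tight_extension {N : Type*} [Fintype N] [DecidableEq N]
    (f : Finset N → ℝ) (K : Set (Finset N))
    (hK0 : K0 N ⊆ K) (hf0 : f ∅ = 0)
    (hext : ∃ g : Finset N → ℝ, SubadditiveSF g ∧ MonotoneStep g ∧ ∀ S ∈ K, g S = f S) :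
    SubadditiveSF (samUpper f K) ∧ MonotoneStep (samUpper f K) ∧
    (∀ S ∈ K, samUpper f K S = f S) ∧
    (∀ S : Finset N, ∃ g : Finset N → ℝ, SubadditiveSF g ∧ MonotoneStep g ∧
      (∀ T ∈ K, g T = f T) ∧ g S = samUpper f K S) := by
  obtain ⟨g, hg, hgm, hfg⟩ := hext
  have hm := hgm.monotoneSF
  have hempty : (∅ : Finset N) ∈ K := hK0 (Or.inl (Or.inl rfl))
  have huniv : (Finset.univ : Finset N) ∈ K := hK0 (Or.inl (Or.inr rfl))
  have h0 : g ∅ = 0 := (hfg _ hempty).trans hf0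
  have hlb : ∀ S, g S ∈ lowerBounds (coverCosts f K S) := fun S _ hx =>
    le_of_mem_coverCosts hg hm h0 hfg hx
  have hne : ∀ S, (coverCosts f K S).Nonempty := fun S =>
    ⟨_, mem_coverCosts_of_subset f huniv (Finset.subset_univ S)⟩
  have hsub : SubadditiveSF (samUpper f K) := by
    intro S T _
    simp only [samUpper_eq_sInf_coverCosts]
    rw [← sub_le_iff_le_add]
    refine le_csInf (hne S) fun x hx => ?_
    rw [sub_le_iff_le_add, ← sub_le_iff_le_add']
    refine le_csInf (hne T) fun y hy => ?_
    rw [sub_le_iff_le_add']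
    exact csInf_le ⟨_, hlb _⟩ (add_mem_coverCosts_union hx hy)
  have hmono : MonotoneStep (samUpper f K) := fun S i _ =>
    csInf_le_csInf ⟨_, hlb S⟩ (hne _) (coverCosts_antitone f K (Finset.subset_insert i S))
  have heq : ∀ S ∈ K, samUpper f K S = f S := by
    intro S hS
    refine le_antisymm (csInf_le ⟨_, hlb S⟩ (mem_coverCosts_of_subset f hS subset_rfl)) ?_
    rw [← hfg S hS]
    exact le_csInf (hne S) (hlb S)
  exact ⟨hsub, hmono, heq, fun S => ⟨samUpper f K, hsub, hmono, heq, rfl⟩⟩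
end
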